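/- arXiv:1910.01991 — 6 statements merged into one kernel-verified Lean document; each statement's English description precedes it below -/
import Mathlib

section
/- Let d ≥ 2, k ≥ 2, and let v₁,…,v_k be nonzero vectors in ℝ^d and γ₁,…,γ_k > 0 positive real coefficients such that Σ_{l=1}^k γ_l v_l = 0. Then there exists a bi-partitioning c₁ ∪ c₂ = {1,…,k} with c₁ and c₂ nonempty and disjoint, such that for all i ∈ c₁ and j ∈ c₂ the cosine similarity satisfies α(v_i, v_j) ≤ cos(π/(k−1)). -/
open RealInnerProductSpace

lemma exists_closed_walk {V : Type*} [Fintype V] [DecidableEq V] (G : SimpleGraph V) (v0 : V)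
    (H : ∀ S : Finset V, S.Nonempty → S ≠ Finset.univ → ∃ i ∈ S, ∃ j, j ∉ S ∧ G.Adj i j)
    (m : ℕ) (hm : m + 1 ≤ Fintype.card V) :
    ∃ (v : V) (p : G.Walk v v), p.length = 2 * m ∧ p.support.toFinset.card = m + 1 := by
  induction m with
  | zero => exact ⟨v0, .nil, by simp, by simp⟩
  | succ m ih =>
    obtain ⟨v, p, hl, hc⟩ := ih (by omega)
    obtain ⟨x, hx, y, hy, hxy⟩ := H p.support.toFinset ⟨v, by simp⟩ (by
      intro h
      rw [h, Finset.card_univ] at hc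
      omega)
    have hx' : x ∈ p.support := by simpa using hx
    refine ⟨x, .cons hxy (.cons hxy.symm (p.rotate x hx')), ?_, ?_⟩
    · have : (p.rotate x hx').length = p.length := by simp
      simp [hl]; omega
    · have h1 : (p.rotate x hx').support.toFinset = p.support.toFinset := by
        ext z; simp
      simp only [SimpleGraph.Walk.support_cons, List.toFinset_cons, h1]
      rw [Finset.insert_eq_of_mem (Finset.mem_insert_of_mem hx), Finset.card_insert_of_notMem hy, hc]

open InnerProductGeometry in
theorem cosine_bipartition (d k : ℕ) (hd : 2 ≤ d) (hk : 2 ≤ k)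
    (v : Fin k → EuclideanSpace ℝ (Fin d)) (hv : ∀ l, v l ≠ 0)
    (γ : Fin k → ℝ) (hγ : ∀ l, 0 < γ l)
    (hsum : ∑ l, γ l • v l = 0) :
    ∃ c₁ c₂ : Finset (Fin k), c₁.Nonempty ∧ c₂.Nonempty ∧ Disjoint c₁ c₂ ∧
      c₁ ∪ c₂ = Finset.univ ∧
      ∀ i ∈ c₁, ∀ j ∈ c₂,
        ⟪v i, v j⟫ / (‖v i‖ * ‖v j‖) ≤ Real.cos (Real.pi / ((k : ℝ) - 1)) := by
  by_contra hcon
  obtain ⟨n, rfl⟩ : ∃ n, k = n + 1 := ⟨k - 1, by omega⟩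
  have hn : (1 : ℝ) ≤ n := by exact_mod_cast (by omega : 1 ≤ n)
  rw [show ((n + 1 : ℕ) : ℝ) - 1 = n by push_cast; ring] at hcon
  set θ := Real.pi / (n : ℝ) with hθ
  have hθ0 : 0 < θ := by have := Real.pi_pos; positivity
  have hnθ : n * θ = Real.pi := by rw [hθ]; field_simp
  let G : SimpleGraph (Fin (n + 1)) :=
    { Adj := fun i j => i ≠ j ∧ angle (v i) (v j) < θ
      symm := ⟨fun i j h => ⟨h.1.symm, by rw [angle_comm]; exact h.2⟩⟩
      loopless := ⟨fun i h => h.1 rfl⟩ }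
  have H : ∀ S : Finset (Fin (n+1)), S.Nonempty → S ≠ Finset.univ →
      ∃ i ∈ S, ∃ j, j ∉ S ∧ G.Adj i j := by
    intro S hS hS'
    by_contra hno
    push Not at hno
    refine hcon ⟨S, Sᶜ, hS, ?_, disjoint_compl_right, by simp, ?_⟩
    · rw [Finset.nonempty_iff_ne_empty]
      simpa using hS'
    · intro i hi j hj
      have hj' : j ∉ S := by simpa using hj
      have h1 := hno i hi j hj'
      have h2 : θ ≤ angle (v i) (v j) := by
        by_contra h
        exact h1 ⟨fun e => hj' (e ▸ hi), not_le.1 h⟩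
      rw [← cos_angle]
      exact Real.cos_le_cos_of_nonneg_of_le_pi hθ0.le (angle_le_pi _ _) h2
  obtain ⟨a, p, hl, hc⟩ := exists_closed_walk G 0 H n (by simp)
  have hall : ∀ x, x ∈ p.support := by
    intro x
    have : p.support.toFinset = Finset.univ := Finset.eq_univ_of_card _ (by simp [hc])
    have h2 : x ∈ p.support.toFinset := by simp [this]
    simpa using h2
  have key : ∀ m i, i + m ≤ 2 * n →
      angle (v (p.getVert i)) (v (p.getVert (i + m))) ≤ m * θ ∧
      (0 < m → angle (v (p.getVert i)) (v (p.getVert (i + m))) < m * θ) := by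
    intro m
    induction m with
    | zero => intro i _; simp [angle_self (hv _)]
    | succ m ih =>
      intro i hi
      have h1 := (ih i (by omega)).1
      have h2 : G.Adj (p.getVert (i + m)) (p.getVert (i + m + 1)) :=
        p.adj_getVert_succ (by omega)
      have h3 := h2.2
      have h4 := angle_le_angle_add_angle (v (p.getVert i)) (v (p.getVert (i + m)))
        (v (p.getVert (i + m + 1)))
      have h5 : angle (v (p.getVert i)) (v (p.getVert (i + (m + 1)))) < (m + 1 : ℕ) * θ := by
        rw [← add_assoc]; push_cast; linarith
      exact ⟨h5.le, fun _ => h5⟩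
  have key2 : ∀ i m l, i + m + l ≤ 2 * n → m + l = n →
      angle (v (p.getVert i)) (v (p.getVert (i + m))) +
      angle (v (p.getVert (i + m))) (v (p.getVert (i + m + l))) < Real.pi := by
    intro i m l h h'
    have h1 := key m i (by omega)
    have h2 := key l (i + m) h
    have h3 : (m : ℝ) * θ + l * θ = Real.pi := by
      rw [← hnθ, ← h']; push_cast; ring
    rcases Nat.eq_zero_or_pos m with h0 | h0
    · have := h2.2 (by omega)
      linarith [h1.1]
    · linarith [h1.2 h0, h2.1]
  set Q := p.getVert n with hQ
  have hend : p.getVert (2 * n) = a := by rw [← hl]; simp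
  have hang : ∀ x, angle (v a) (v x) + angle (v x) (v Q) < Real.pi := by
    intro x
    obtain ⟨i, hi, hil⟩ := SimpleGraph.Walk.mem_support_iff_exists_getVert.1 (hall x)
    rw [hl] at hil
    rcases le_total i n with h | h
    · have := key2 0 i (n - i) (by omega) (by omega)
      rw [show 0 + i + (n - i) = n by omega, zero_add, hi, p.getVert_zero] at this
      exact this
    · have := key2 n (i - n) (2 * n - i) (by omega) (by omega)
      rw [show n + (i - n) + (2 * n - i) = 2 * n by omega, show n + (i - n) = i by omega, hi,
        hend] at this
      rw [angle_comm (v a) (v x), angle_comm (v x) (v Q), hQ]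
      linarith
  set u := ‖v a‖⁻¹ • v a + ‖v Q‖⁻¹ • v Q with hu
  have hpos : ∀ x, 0 < ⟪u, v x⟫ := by
    intro x
    have hx := norm_pos_iff.2 (hv x)
    have ha := norm_pos_iff.2 (hv a)
    have hq := norm_pos_iff.2 (hv Q)
    have h1 : ⟪u, v x⟫ = ‖v x‖ * (Real.cos (angle (v a) (v x)) + Real.cos (angle (v x) (v Q))) := by
      rw [hu, inner_add_left, real_inner_smul_left, real_inner_smul_left, cos_angle, cos_angle,
        real_inner_comm (v x) (v Q)]
      field_simp
    rw [h1]
    refine mul_pos hx ?_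
    have h2 : Real.cos (Real.pi - angle (v x) (v Q)) < Real.cos (angle (v a) (v x)) :=
      Real.cos_lt_cos_of_nonneg_of_le_pi (angle_nonneg _ _)
        (by linarith [angle_nonneg (v x) (v Q)]) (by linarith [hang x])
    rw [Real.cos_pi_sub] at h2
    linarith
  have h0 : ⟪u, ∑ l, γ l • v l⟫ = 0 := by rw [hsum, inner_zero_right]
  rw [inner_sum] at h0
  have : 0 < ∑ l, ⟪u, γ l • v l⟫ := by
    apply Finset.sum_pos
    · intro l _
      rw [real_inner_smul_right]
      exact mul_pos (hγ l) (hpos l)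
    · exact ⟨0, Finset.mem_univ _⟩
  linarith
end

section
/- Let v, X, Y ∈ ℝ^d with ‖X‖ < ‖v‖ and ‖Y‖ < ‖v‖. Then the cosine similarity between v+X and v+Y (both of which are nonzero) satisfies α(v+X, v+Y) ≥ −(‖X‖·‖Y‖)/‖v‖² + √(1 − ‖X‖²/‖v‖²) · √(1 − ‖Y‖²/‖v‖²). -/
open RealInnerProductSpace

lemma aux_angle {d : ℕ} (v X : EuclideanSpace ℝ (Fin d)) (hX : ‖X‖ < ‖v‖) :
    InnerProductGeometry.angle (v + X) v ≤ Real.arcsin (‖X‖ / ‖v‖) := by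
  have hv : 0 < ‖v‖ := lt_of_le_of_lt (norm_nonneg _) hX
  have hne : v + X ≠ 0 := by
    intro h
    have h1 : v = -X := eq_neg_of_add_eq_zero_left h
    rw [h1, norm_neg] at hX
    exact lt_irrefl _ hX
  have hn : 0 < ‖v + X‖ := norm_pos_iff.mpr hne
  rw [Real.arcsin_eq_arccos (by positivity)]
  unfold InnerProductGeometry.angle
  apply Real.arccos_le_arccos
  have hin : ⟪v + X, v⟫ = ‖v‖ ^ 2 + ⟪v, X⟫ := by
    rw [inner_add_left, real_inner_self_eq_norm_sq, real_inner_comm]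
  have hsq : ‖v + X‖ ^ 2 = ‖v‖ ^ 2 + 2 * ⟪v, X⟫ + ‖X‖ ^ 2 := norm_add_sq_real v X
  have hab : -(‖v‖ * ‖X‖) ≤ ⟪v, X⟫ := (abs_le.mp (abs_real_inner_le_norm v X)).1
  have hpos : 0 ≤ ⟪v + X, v⟫ := by
    rw [hin]; nlinarith
  apply Real.sqrt_le_iff.mpr
  refine ⟨by positivity, ?_⟩
  rw [div_pow, div_pow, mul_pow, hin, hsq, le_div_iff₀ (by rw [← hsq]; positivity)]
  have e : (1 - ‖X‖ ^ 2 / ‖v‖ ^ 2) * ((‖v‖ ^ 2 + 2 * ⟪v, X⟫ + ‖X‖ ^ 2) * ‖v‖ ^ 2)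
      = (‖v‖ ^ 2 - ‖X‖ ^ 2) * (‖v‖ ^ 2 + 2 * ⟪v, X⟫ + ‖X‖ ^ 2) := by
    field_simp
  rw [e]
  nlinarith [sq_nonneg (⟪v, X⟫ + ‖X‖ ^ 2)]

/-- Lower bound on the cosine similarity between two noisy approximations of the
same vector `v`. -/
theorem cosine_same_vector_lower_bound (d : ℕ) (v X Y : EuclideanSpace ℝ (Fin d))
    (hX : ‖X‖ < ‖v‖) (hY : ‖Y‖ < ‖v‖) :
    ⟪v + X, v + Y⟫ / (‖v + X‖ * ‖v + Y‖) ≥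
      -(‖X‖ * ‖Y‖) / ‖v‖ ^ 2 +
        Real.sqrt (1 - ‖X‖ ^ 2 / ‖v‖ ^ 2) * Real.sqrt (1 - ‖Y‖ ^ 2 / ‖v‖ ^ 2) := by
  have hv : 0 < ‖v‖ := lt_of_le_of_lt (norm_nonneg _) hX
  have h1 := aux_angle v X hX
  have h2 := aux_angle v Y hY
  rw [InnerProductGeometry.angle_comm] at h2
  have h3 := InnerProductGeometry.angle_le_angle_add_angle (v + X) v (v + Y)
  have hx0 : 0 ≤ ‖X‖ / ‖v‖ := by positivity
  have hy0 : 0 ≤ ‖Y‖ / ‖v‖ := by positivity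
  have hx1 : ‖X‖ / ‖v‖ ≤ 1 := (div_le_one hv).mpr hX.le
  have hy1 : ‖Y‖ / ‖v‖ ≤ 1 := (div_le_one hv).mpr hY.le
  have h4 := Real.cos_le_cos_of_nonneg_of_le_pi (InnerProductGeometry.angle_nonneg (v + X) (v + Y))
    (by linarith [Real.arcsin_le_pi_div_two (‖X‖ / ‖v‖), Real.arcsin_le_pi_div_two (‖Y‖ / ‖v‖)])
    (h3.trans (add_le_add h1 h2))
  rw [InnerProductGeometry.cos_angle, Real.cos_add, Real.cos_arcsin, Real.cos_arcsin,
    Real.sin_arcsin (by linarith) hx1, Real.sin_arcsin (by linarith) hy1, div_pow, div_pow] at h4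
  have e : -(‖X‖ * ‖Y‖) / ‖v‖ ^ 2 = -(‖X‖ / ‖v‖ * (‖Y‖ / ‖v‖)) := by
    field_simp
  rw [e]
  linarith
end

section
/- (Separation Theorem, cross-cluster bound.) Let d ≥ 2, k ≥ 2, m ≥ k. Let G₁,…,G_k ∈ ℝ^d be nonzero vectors (the true risk gradients of the k data generating distributions at a stationary point), let a₁,…,a_k > 0 be positive coefficients with Σ_{l=1}^k a_l G_l = 0 (stationarity of the Federated Learning objective), let I : {1,…,m} → {1,…,k} be a surjective assignment of clients to distributions, and let g₁,…,g_m ∈ ℝ^d (the empirical risk gradients) satisfy ‖G_{I(i)}‖ > ‖G_{I(i)} − g_i‖ for all i. Define γ_i := ‖G_{I(i)} − g_i‖/‖G_{I(i)}‖ ∈ [0,1) and H_{i,j} := −γ_i·γ_j + √(1−γ_i²)·√(1−γ_j²). Then there exists a bi-partitioning c₁* ∪ c₂* = {1,…,m} with c₁*, c₂* nonempty and disjoint, such that for all i ∈ c₁* and j ∈ c₂*: if H_{i,j} ≥ cos(π/(k−1)) then α(g_i, g_j) ≤ cos(π/(k−1))·H_{i,j} + sin(π/(k−1))·√(1 − H_{i,j}²),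 and in any case α(g_i, g_j) ≤ 1. -/
open RealInnerProductSpace

open InnerProductGeometry in
theorem glue_aux {V : Type*} [NormedAddCommGroup V] [InnerProductSpace ℝ V] {r x y : V} {A B : ℝ}
    (hx : x ≠ 0) (hy : y ≠ 0) (hA : angle r x ≤ A) (hB : angle r y ≤ B) (hAB : A + B < Real.pi) :
    x + y ≠ 0 ∧ angle r (x + y) ≤ A + B := by
  have hxy : angle x y ≤ angle x r + angle r y := angle_le_angle_add_angle x r y
  rw [angle_comm x r] at hxy
  refine ⟨fun h => ?_, ?_⟩
  · have h2 : y = -x := by rw [eq_neg_iff_add_eq_zero, add_comm]; exact h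
    rw [h2, angle_self_neg_of_nonzero hx, ← h2] at hxy
    linarith
  · have h1 := angle_eq_angle_add_add_angle_add x hy
    have h2 := angle_le_angle_add_angle r x (x + y)
    have h3 := angle_le_angle_add_angle r y (x + y)
    linarith

/-- Sums over clusters joined by a tree of total angular length at most `C` do not vanish. -/
def TreeLike {V : Type*} [NormedAddCommGroup V] [InnerProductSpace ℝ V] {ι : Type*}
    (G : ι → V) (T : Finset ι) (C : ℝ) : Prop :=
  ∀ (X : ι → V) (L : ι → ℝ), (∀ i ∈ T, X i ≠ 0) →
    (∀ i ∈ T, InnerProductGeometry.angle (G i) (X i) ≤ L i) →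
    ∑ i ∈ T, L i + C < Real.pi → ∑ i ∈ T, X i ≠ 0

open InnerProductGeometry in
theorem TreeLike.grow {V : Type*} [NormedAddCommGroup V] [InnerProductSpace ℝ V] {ι : Type*}
    [DecidableEq ι] {G : ι → V} {T : Finset ι} {C : ℝ} (hC : 0 ≤ C) (h : TreeLike G T C) {u w : ι}
    (hu : u ∉ T) (hw : w ∈ T) : TreeLike G (insert u T) (C + angle (G w) (G u)) := by
  intro X L hX hL hlt
  rw [Finset.sum_insert hu] at hlt ⊢
  have hLw : L w ≤ ∑ i ∈ T, L i := by
    refine Finset.single_le_sum (f := L) (fun i hi => ?_) hw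
    exact (angle_nonneg _ _).trans (hL i (Finset.mem_insert_of_mem hi))
  have hwu : angle (G w) (X u) ≤ L u + angle (G w) (G u) := by
    have h1 := angle_le_angle_add_angle (G w) (G u) (X u)
    have h2 := hL u (Finset.mem_insert_self _ _)
    linarith
  have hglue := glue_aux (hX w (Finset.mem_insert_of_mem hw)) (hX u (Finset.mem_insert_self _ _))
    (hL w (Finset.mem_insert_of_mem hw)) hwu (by linarith)
  have key := h (fun i => X i + if i = w then X u else 0)
    (fun i => L i + if i = w then L u + angle (G w) (G u) else 0) ?_ ?_ ?_
  · simp only [Finset.sum_add_distrib, Finset.sum_ite_eq', hw, if_true] at key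
    rwa [add_comm]
  · intro i hi
    by_cases hiw : i = w
    · subst hiw; simpa using hglue.1
    · simpa [hiw] using hX i (Finset.mem_insert_of_mem hi)
  · intro i hi
    by_cases hiw : i = w
    · subst hiw; simpa using hglue.2
    · simpa [hiw] using hL i (Finset.mem_insert_of_mem hi)
  · simp only [Finset.sum_add_distrib, Finset.sum_ite_eq', hw, if_true]
    linarith

open InnerProductGeometry in
theorem exists_cut {V : Type*} [NormedAddCommGroup V] [InnerProductSpace ℝ V] (k : ℕ) (hk : 2 ≤ k)
    (G : Fin k → V) (hG : ∀ l, G l ≠ 0)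
    (a : Fin k → ℝ) (ha : ∀ l, 0 < a l) (hsum : ∑ l, a l • G l = 0) :
    ∃ T : Finset (Fin k), T.Nonempty ∧ T ≠ Finset.univ ∧
      ∀ i ∈ T, ∀ j ∉ T, Real.pi / ((k : ℝ) - 1) ≤ angle (G i) (G j) := by
  classical
  set θ := Real.pi / ((k : ℝ) - 1) with hθ
  have hk' : (2 : ℝ) ≤ k := by exact_mod_cast hk
  by_contra! hcon
  have main : ∀ n : ℕ, n + 1 ≤ k → ∃ (T : Finset (Fin k)) (C : ℝ), T.card = n + 1 ∧ 0 ≤ C ∧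
      C ≤ θ * n ∧ (0 < n → C < θ * n) ∧ TreeLike G T C := by
    intro n
    induction n with
    | zero =>
      intro _
      refine ⟨{⟨0, by omega⟩}, 0, by simp, le_rfl, by simp, by simp, ?_⟩
      intro X L hX _ _
      simpa using hX
    | succ n ih =>
      intro hn
      obtain ⟨T, C, hcard, hC, hle, -, hT⟩ := ih (by omega)
      obtain ⟨w, hw, u, hu, hlt⟩ := hcon T (Finset.card_pos.mp (by omega)) (by
        rintro rfl
        simp at hcard
        omega)
      refine ⟨insert u T, C + angle (G w) (G u), ?_, ?_, ?_, ?_, hT.grow hC hu hw⟩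
      · rw [Finset.card_insert_of_notMem hu, hcard]
      · have := angle_nonneg (G w) (G u); linarith
      · push_cast; linarith
      · intro _; push_cast; linarith
  obtain ⟨T, C, hcard, hC, -, hlt, hT⟩ := main (k - 1) (by omega)
  have hTu : T = Finset.univ := by
    rw [← Finset.card_eq_iff_eq_univ, hcard, Fintype.card_fin]; omega
  subst hTu
  have hlt' := hlt (by omega)
  rw [Nat.cast_sub (by omega), Nat.cast_one, hθ, div_mul_cancel₀ _ (by linarith)] at hlt'
  refine hT (fun l => a l • G l) (fun _ => 0) (fun i _ => smul_ne_zero (ha i).ne' (hG i)) ?_ ?_ hsum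
  · intro i _
    rw [angle_smul_right_of_pos _ _ (ha i), angle_self (hG i)]
  · simpa using hlt'

open InnerProductGeometry in
theorem angle_noise {V : Type*} [NormedAddCommGroup V] [InnerProductSpace ℝ V] {x y : V} {γ : ℝ}
    (h : ‖x - y‖ < ‖x‖) (hγ : γ = ‖x - y‖ / ‖x‖) :
    0 ≤ γ ∧ γ < 1 ∧ angle x y ≤ Real.arcsin γ := by
  have hx : 0 < ‖x‖ := (norm_nonneg _).trans_lt h
  have hy : 0 < ‖y‖ := by
    rw [norm_pos_iff]; rintro rfl; simp at h
  have h0 : 0 ≤ γ := by rw [hγ]; positivity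
  have h1 : γ < 1 := by rw [hγ, div_lt_one hx]; exact h
  refine ⟨h0, h1, ?_⟩
  have hγ2 : 0 ≤ 1 - γ ^ 2 := by nlinarith
  have hs := Real.sq_sqrt hγ2
  rw [Real.arcsin_eq_arccos h0]
  refine Real.arccos_le_arccos ?_
  rw [le_div_iff₀ (by positivity)]
  have hn : ‖x - y‖ = γ * ‖x‖ := by rw [hγ]; field_simp
  have hexp := norm_sub_sq_real x y
  rw [hn] at hexp
  nlinarith [sq_nonneg (Real.sqrt (1 - γ ^ 2) * ‖x‖ - ‖y‖)]

/-- Separation Theorem, cross-cluster bound. -/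
theorem separation_theorem_cross (d k m : ℕ) (hd : 2 ≤ d) (hk : 2 ≤ k) (hm : k ≤ m)
    (G : Fin k → EuclideanSpace ℝ (Fin d)) (hG : ∀ l, G l ≠ 0)
    (a : Fin k → ℝ) (ha : ∀ l, 0 < a l) (hsum : ∑ l, a l • G l = 0)
    (I : Fin m → Fin k) (hI : Function.Surjective I)
    (g : Fin m → EuclideanSpace ℝ (Fin d))
    (hnoise : ∀ i, ‖G (I i) - g i‖ < ‖G (I i)‖)
    (γ : Fin m → ℝ) (hγ : ∀ i, γ i = ‖G (I i) - g i‖ / ‖G (I i)‖)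
    (H : Fin m → Fin m → ℝ)
    (hH : ∀ i j, H i j = -(γ i * γ j) +
      Real.sqrt (1 - γ i ^ 2) * Real.sqrt (1 - γ j ^ 2)) :
    ∃ c₁ c₂ : Finset (Fin m), c₁.Nonempty ∧ c₂.Nonempty ∧ Disjoint c₁ c₂ ∧
      c₁ ∪ c₂ = Finset.univ ∧
      ∀ i ∈ c₁, ∀ j ∈ c₂,
        (Real.cos (Real.pi / ((k : ℝ) - 1)) ≤ H i j →
          ⟪g i, g j⟫ / (‖g i‖ * ‖g j‖) ≤
            Real.cos (Real.pi / ((k : ℝ) - 1)) * H i j +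
              Real.sin (Real.pi / ((k : ℝ) - 1)) * Real.sqrt (1 - H i j ^ 2)) ∧
        ⟪g i, g j⟫ / (‖g i‖ * ‖g j‖) ≤ 1 := by
  classical
  obtain ⟨T, hTne, hTu, hT⟩ := exists_cut k hk G hG a ha hsum
  have hk' : (2 : ℝ) ≤ k := by exact_mod_cast hk
  set θ := Real.pi / ((k : ℝ) - 1) with hθ
  have hθ0 : 0 ≤ θ := div_nonneg Real.pi_pos.le (by linarith)
  have hθπ : θ ≤ Real.pi := div_le_self Real.pi_pos.le (by linarith)
  refine ⟨Finset.univ.filter (fun i => I i ∈ T), Finset.univ.filter (fun i => I i ∉ T),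
    ?_, ?_, Finset.disjoint_filter_filter_not _ _ _, Finset.filter_union_filter_not_eq _ _, ?_⟩
  · obtain ⟨l, hl⟩ := hTne
    obtain ⟨i, rfl⟩ := hI l
    exact ⟨i, by simpa using hl⟩
  · obtain ⟨l, hl⟩ : ∃ l, l ∉ T := by
      by_contra! h
      exact hTu (Finset.eq_univ_iff_forall.mpr h)
    obtain ⟨i, rfl⟩ := hI l
    exact ⟨i, by simpa using hl⟩
  intro i hi j hj
  simp only [Finset.mem_filter, Finset.mem_univ, true_and] at hi hj
  have hang := hT _ hi _ hj
  rw [← InnerProductGeometry.cos_angle]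
  refine ⟨fun hle => ?_, Real.cos_le_one _⟩
  obtain ⟨hi0, hi1, hia⟩ := angle_noise (hnoise i) (hγ i)
  obtain ⟨hj0, hj1, hja⟩ := angle_noise (hnoise j) (hγ j)
  have hHc : H i j = Real.cos (Real.arcsin (γ i) + Real.arcsin (γ j)) := by
    rw [hH, Real.cos_add, Real.cos_arcsin, Real.cos_arcsin,
      Real.sin_arcsin (by linarith) hi1.le, Real.sin_arcsin (by linarith) hj1.le]
    ring
  have hbi := Real.arcsin_nonneg.mpr hi0
  have hbj := Real.arcsin_nonneg.mpr hj0
  have hbi' := Real.arcsin_le_pi_div_two (γ i)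
  have hbj' := Real.arcsin_le_pi_div_two (γ j)
  set β := Real.arcsin (γ i) + Real.arcsin (γ j) with hβ
  have hsqrt : Real.sqrt (1 - H i j ^ 2) = Real.sin β := by
    rw [hHc, ← Real.sin_sq, Real.sqrt_sq]
    exact Real.sin_nonneg_of_nonneg_of_le_pi (by linarith) (by linarith)
  rw [hsqrt, hHc, ← Real.cos_sub]
  rw [hHc] at hle
  have hβθ : β ≤ θ := by
    by_contra! h
    have := Real.cos_lt_cos_of_nonneg_of_le_pi hθ0 (by linarith : β ≤ Real.pi) h
    linarith
  refine Real.cos_le_cos_of_nonneg_of_le_pi (by linarith)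
    (InnerProductGeometry.angle_le_pi _ _) ?_
  have t1 := InnerProductGeometry.angle_le_angle_add_angle (G (I i)) (g i) (G (I j))
  have t2 := InnerProductGeometry.angle_le_angle_add_angle (g i) (g j) (G (I j))
  rw [InnerProductGeometry.angle_comm (g j)] at t2
  linarith
end

section
/- (Separation Theorem, intra-cluster bound.) Let g₁,…,g_m ∈ ℝ^d, let I : {1,…,m} → {1,…,k} be an assignment of clients to distributions, and let G₁,…,G_k ∈ ℝ^d satisfy ‖G_{I(i)}‖ > ‖G_{I(i)} − g_i‖ for all i. Define γ_i := ‖G_{I(i)} − g_i‖/‖G_{I(i)}‖ ∈ [0,1). Then for all i, j ∈ {1,…,m} with I(i) = I(j), the cosine similarity satisfies α(g_i, g_j) ≥ −γ_i·γ_j + √(1−γ_i²)·√(1−γ_j²). -/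
open RealInnerProductSpace

lemma angle_aux {V : Type*} [NormedAddCommGroup V] [InnerProductSpace ℝ V] (a b : V) (c : ℝ)
    (h : ‖a - b‖ < ‖a‖) (hc : c = ‖a - b‖ / ‖a‖) :
    InnerProductGeometry.angle a b ≤ Real.arcsin c ∧ 0 ≤ c ∧ c < 1 ∧ b ≠ 0 := by
  have ha : 0 < ‖a‖ := lt_of_le_of_lt (norm_nonneg _) h
  have hb : b ≠ 0 := by
    rintro rfl
    simp at h
  have hb' : 0 < ‖b‖ := norm_pos_iff.mpr hb
  have h0 : 0 ≤ c := by rw [hc]; positivity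
  have h1 : c < 1 := by rw [hc]; exact (div_lt_one ha).mpr h
  refine ⟨?_, h0, h1, hb⟩
  rw [Real.arcsin_eq_arccos h0]
  unfold InnerProductGeometry.angle
  apply Real.arccos_le_arccos
  rw [le_div_iff₀ (by positivity)]
  have hn := norm_sub_sq_real a b
  have hs : Real.sqrt (1 - c ^ 2) ^ 2 = 1 - c ^ 2 := Real.sq_sqrt (by nlinarith)
  have hca : c * ‖a‖ = ‖a - b‖ := by rw [hc]; field_simp
  have e : (Real.sqrt (1 - c ^ 2) * ‖a‖) ^ 2 = ‖a‖ ^ 2 - ‖a - b‖ ^ 2 := by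
    rw [mul_pow, hs, ← hca]; ring
  nlinarith [sq_nonneg (Real.sqrt (1 - c ^ 2) * ‖a‖ - ‖b‖)]

/-- Separation Theorem, intra-cluster bound. -/
theorem separation_theorem_intra (d k m : ℕ)
    (g : Fin m → EuclideanSpace ℝ (Fin d))
    (I : Fin m → Fin k)
    (G : Fin k → EuclideanSpace ℝ (Fin d))
    (hnoise : ∀ i, ‖G (I i) - g i‖ < ‖G (I i)‖)
    (γ : Fin m → ℝ) (hγ : ∀ i, γ i = ‖G (I i) - g i‖ / ‖G (I i)‖) :
    ∀ i j, I i = I j →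
      ⟪g i, g j⟫ / (‖g i‖ * ‖g j‖) ≥
        -(γ i * γ j) + Real.sqrt (1 - γ i ^ 2) * Real.sqrt (1 - γ j ^ 2) := by
  intro i j hij
  obtain ⟨ai, i0, i1, -⟩ := angle_aux _ _ _ (hnoise i) (hγ i)
  obtain ⟨aj, j0, j1, -⟩ := angle_aux _ _ _ (hnoise j) (hγ j)
  rw [← hij] at aj
  have ht := InnerProductGeometry.angle_le_angle_add_angle (g i) (G (I i)) (g j)
  rw [InnerProductGeometry.angle_comm (g i) (G (I i))] at ht
  have hc := Real.cos_le_cos_of_nonneg_of_le_pi (InnerProductGeometry.angle_nonneg (g i) (g j))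
    (by linarith [Real.arcsin_le_pi_div_two (γ i), Real.arcsin_le_pi_div_two (γ j)])
    (show _ ≤ Real.arcsin (γ i) + Real.arcsin (γ j) by linarith)
  rw [InnerProductGeometry.cos_angle, Real.cos_add, Real.cos_arcsin, Real.cos_arcsin,
    Real.sin_arcsin (by linarith) i1.le, Real.sin_arcsin (by linarith) j1.le] at hc
  linarith
end

section
/- (Separation Theorem, case k = 2.) Let d ≥ 2, m ≥ 2. Let G₁, G₂ ∈ ℝ^d be nonzero vectors with a₁ G₁ + a₂ G₂ = 0 for some a₁, a₂ > 0, let I : {1,…,m} → {1,2} be surjective, and let g₁,…,g_m ∈ ℝ^d satisfy ‖G_{I(i)}‖ > ‖G_{I(i)} − g_i‖ for all i. Define γ_i := ‖G_{I(i)} − g_i‖/‖G_{I(i)}‖ ∈ [0,1) and H_{i,j} := −γ_i·γ_j + √(1−γ_i²)·√(1−γ_j²). Then there exists a bi-partitioning c₁* ∪ c₂* = {1,…,m}, with c₁*, c₂* nonempty and disjoint, such that α(g_i, g_j) ≤ −H_{i,j} for all i ∈ c₁* and j ∈ c₂*. -/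
open RealInnerProductSpace

lemma aux_angle_s6 {E : Type*} [NormedAddCommGroup E] [InnerProductSpace ℝ E] (G g : E)
    (h : ‖G - g‖ < ‖G‖) :
    InnerProductGeometry.angle G g ≤ Real.arcsin (‖G - g‖ / ‖G‖) := by
  have hG : 0 < ‖G‖ := lt_of_le_of_lt (norm_nonneg _) h
  have hg : 0 < ‖g‖ := by
    rw [norm_pos_iff]
    rintro rfl
    simp at h
  have hγ0 : 0 ≤ ‖G - g‖ / ‖G‖ := by positivity
  have hγ1 : ‖G - g‖ / ‖G‖ < 1 := (div_lt_one hG).2 h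
  rw [Real.arcsin_eq_arccos hγ0]
  unfold InnerProductGeometry.angle
  apply Real.arccos_le_arccos
  rw [le_div_iff₀ (by positivity)]
  have hn := norm_sub_sq_real G g
  have hGg : ‖G - g‖ = ‖G - g‖ / ‖G‖ * ‖G‖ := by field_simp
  set c := ‖G - g‖ / ‖G‖
  have hs : Real.sqrt (1 - c ^ 2) ^ 2 = 1 - c ^ 2 := Real.sq_sqrt (by nlinarith)
  set s := Real.sqrt (1 - c ^ 2)
  rw [hGg] at hn
  have h2 : (s * ‖G‖) ^ 2 = ‖G‖ ^ 2 - (c * ‖G‖) ^ 2 := by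
    rw [mul_pow, hs]; ring
  nlinarith [sq_nonneg (s * ‖G‖ - ‖g‖)]

/-- Separation Theorem in the case of `k = 2` data generating distributions. -/
theorem separation_theorem_two_clusters (d m : ℕ) (hd : 2 ≤ d) (hm : 2 ≤ m)
    (G : Fin 2 → EuclideanSpace ℝ (Fin d)) (hG : ∀ l, G l ≠ 0)
    (a : Fin 2 → ℝ) (ha : ∀ l, 0 < a l)
    (hsum : a 0 • G 0 + a 1 • G 1 = 0)
    (I : Fin m → Fin 2) (hI : Function.Surjective I)
    (g : Fin m → EuclideanSpace ℝ (Fin d))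
    (hnoise : ∀ i, ‖G (I i) - g i‖ < ‖G (I i)‖)
    (γ : Fin m → ℝ) (hγ : ∀ i, γ i = ‖G (I i) - g i‖ / ‖G (I i)‖)
    (H : Fin m → Fin m → ℝ)
    (hH : ∀ i j, H i j = -(γ i * γ j) +
      Real.sqrt (1 - γ i ^ 2) * Real.sqrt (1 - γ j ^ 2)) :
    ∃ c₁ c₂ : Finset (Fin m), c₁.Nonempty ∧ c₂.Nonempty ∧ Disjoint c₁ c₂ ∧
      c₁ ∪ c₂ = Finset.univ ∧
      ∀ i ∈ c₁, ∀ j ∈ c₂,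
        ⟪g i, g j⟫ / (‖g i‖ * ‖g j‖) ≤ -H i j := by
  classical
  refine ⟨Finset.univ.filter (fun i => I i = 0), Finset.univ.filter (fun i => I i = 1),
    ?_, ?_, ?_, ?_, ?_⟩
  · obtain ⟨i, hi⟩ := hI 0
    exact ⟨i, by simp [hi]⟩
  · obtain ⟨i, hi⟩ := hI 1
    exact ⟨i, by simp [hi]⟩
  · rw [Finset.disjoint_left]
    intro i h1 h2
    simp at h1 h2
    simp [h1] at h2
  · ext i
    simp
    omega
  · intro i hi j hj
    simp only [Finset.mem_filter, Finset.mem_univ, true_and] at hi hj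
    have h1 := aux_angle_s6 _ _ (hnoise i)
    have h2 := aux_angle_s6 _ _ (hnoise j)
    have hb : ∀ i, 0 ≤ γ i ∧ γ i < 1 := by
      intro i
      rw [hγ]
      exact ⟨by positivity, (div_lt_one (norm_pos_iff.2 (hG _))).2 (hnoise i)⟩
    rw [← hγ] at h1 h2
    rw [hi] at h1
    rw [hj] at h2
    have hG1 : G 1 = (a 0 / a 1) • (-G 0) := by
      have h3 : a 1 • G 1 = -(a 0 • G 0) := by
        rw [eq_neg_iff_add_eq_zero, add_comm]; exact hsum
      have h4 : (a 1)⁻¹ • (a 1 • G 1) = G 1 := inv_smul_smul₀ (ha 1).ne' _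
      rw [← h4, h3, smul_neg, smul_neg, smul_smul]
      congr 2
      field_simp
    rw [hG1, InnerProductGeometry.angle_smul_left_of_pos _ _ (div_pos (ha 0) (ha 1)),
      InnerProductGeometry.angle_neg_left] at h2
    have h5 := InnerProductGeometry.angle_le_angle_add_angle (G 0) (g i) (g j)
    have hti := Real.arcsin_le_pi_div_two (γ i)
    have htj := Real.arcsin_le_pi_div_two (γ j)
    have h6 := Real.cos_le_cos_of_nonneg_of_le_pi
      (x := Real.pi - (Real.arcsin (γ i) + Real.arcsin (γ j)))
      (y := InnerProductGeometry.angle (g i) (g j)) (by linarith)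
      (InnerProductGeometry.angle_le_pi _ _) (by linarith)
    rw [InnerProductGeometry.cos_angle, Real.cos_pi_sub, Real.cos_add, Real.cos_arcsin,
      Real.cos_arcsin, Real.sin_arcsin (by linarith [(hb i).1]) (hb i).2.le,
      Real.sin_arcsin (by linarith [(hb j).1]) (hb j).2.le] at h6
    rw [hH]
    linarith
end

section
/- (Sufficient noise condition for correct clustering.) Let d ≥ 2, k ≥ 2, m ≥ k. Let G₁,…,G_k ∈ ℝ^d be nonzero vectors, a₁,…,a_k > 0 with Σ_{l=1}^k a_l G_l = 0, I : {1,…,m} → {1,…,k} surjective, and g₁,…,g_m ∈ ℝ^d with ‖G_{I(i)}‖ > ‖G_{I(i)} − g_i‖ for all i. Define γ_i := ‖G_{I(i)} − g_i‖/‖G_{I(i)}‖, γ_max := max_i γ_i, α_{i,j} := α(g_i, g_j), and α_cross^max := min over all bi-partitionings c₁ ∪ c₂ = {1,…,m} (c₁, c₂ nonempty, disjoint) of (max over i ∈ c₁, j ∈ c₂ of α_{i,j}). If γ_max < √((1 − α_cross^max)/2), then every bi-partitioning (c₁, c₂) achieving α_cross^max is correct: I(i) ≠ I(j) for all i ∈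 c₁, j ∈ c₂. -/
open RealInnerProductSpace

lemma le_of_sq_le_sq_aux {a b : ℝ} (h : a ^ 2 ≤ b ^ 2) (hb : 0 ≤ b) : a ≤ b :=
  le_trans (le_abs_self a) (abs_le_of_sq_le_sq h hb)

lemma aux_angle_s10 {E : Type*} [NormedAddCommGroup E] [InnerProductSpace ℝ E] (x y : E)
    (h : ‖x - y‖ < ‖x‖) (s : ℝ) (hs1 : s ≤ 1) (hs : ‖x - y‖ / ‖x‖ < s) :
    InnerProductGeometry.angle x y < Real.arcsin s := by
  have hx : 0 < ‖x‖ := lt_of_le_of_lt (norm_nonneg _) h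
  have hexp := norm_sub_sq_real x y
  have hc := InnerProductGeometry.cos_angle_mul_norm_mul_norm x y
  have hpi : InnerProductGeometry.angle x y < Real.pi / 2 := by
    have hy : 0 < ‖y‖ := by
      rw [norm_pos_iff]
      rintro rfl
      simp at h
    rw [InnerProductGeometry.angle, Real.arccos_lt_pi_div_two]
    refine div_pos ?_ (mul_pos hx hy)
    nlinarith [norm_nonneg (x - y), sq_nonneg ‖y‖]
  have h0 := InnerProductGeometry.angle_nonneg x y
  have hsin0 := InnerProductGeometry.sin_angle_nonneg x y
  have hsc := Real.sin_sq_add_cos_sq (InnerProductGeometry.angle x y)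
  set θ := InnerProductGeometry.angle x y
  have hle : Real.sin θ * ‖x‖ ≤ ‖x - y‖ := by
    apply le_of_sq_le_sq_aux ?_ (norm_nonneg _)
    have : Real.sin θ ^ 2 = 1 - Real.cos θ ^ 2 := by linarith
    rw [mul_pow, this, hexp, ← hc]
    nlinarith [sq_nonneg (‖y‖ - Real.cos θ * ‖x‖)]
  have hlt : Real.sin θ < s := lt_of_le_of_lt ((le_div_iff₀ hx).2 hle) hs
  rw [Real.lt_arcsin_iff_sin_lt ⟨by linarith [Real.pi_pos], hpi.le⟩ ⟨by linarith, hs1⟩]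
  exact hlt

/-- Sufficient noise condition for correct clustering: if every relative
approximation error `γ i` (hence `γ_max`) is smaller than
`√((1 - α_cross^max) / 2)`, then every bipartitioning achieving the optimal
cross-cluster similarity is correct. -/
theorem noise_condition_correct_clustering (d k m : ℕ)
    (hd : 2 ≤ d) (hk : 2 ≤ k) (hm : k ≤ m)
    (G : Fin k → EuclideanSpace ℝ (Fin d)) (hG : ∀ l, G l ≠ 0)
    (a : Fin k → ℝ) (ha : ∀ l, 0 < a l) (hsum : ∑ l, a l • G l = 0)
    (I : Fin m → Fin k) (hI : Function.Surjective I)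
    (g : Fin m → EuclideanSpace ℝ (Fin d))
    (hnoise : ∀ i, ‖G (I i) - g i‖ < ‖G (I i)‖)
    (γ : Fin m → ℝ) (hγ : ∀ i, γ i = ‖G (I i) - g i‖ / ‖G (I i)‖)
    (α : Fin m → Fin m → ℝ)
    (hα : ∀ i j, α i j = ⟪g i, g j⟫ / (‖g i‖ * ‖g j‖))
    (c₁ c₂ : Finset (Fin m)) (h1 : c₁.Nonempty) (h2 : c₂.Nonempty)
    (hdisj : Disjoint c₁ c₂) (hunion : c₁ ∪ c₂ = Finset.univ)
    -- (c₁, c₂) achieves the optimal cross-cluster similarity α_cross^max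
    (hopt : ∀ (d₁ d₂ : Finset (Fin m)) (hd1 : d₁.Nonempty) (hd2 : d₂.Nonempty),
      Disjoint d₁ d₂ → d₁ ∪ d₂ = Finset.univ →
      (c₁ ×ˢ c₂).sup' (h1.product h2) (fun p => α p.1 p.2) ≤
        (d₁ ×ˢ d₂).sup' (hd1.product hd2) (fun p => α p.1 p.2))
    -- γ_max < √((1 - α_cross^max)/2)
    (hcrit : ∀ i, γ i <
      Real.sqrt ((1 - (c₁ ×ˢ c₂).sup' (h1.product h2) (fun p => α p.1 p.2)) / 2)) :
    ∀ i ∈ c₁, ∀ j ∈ c₂, I i ≠ I j := by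
  intro i hi j hj hij
  have hS : α i j ≤ (c₁ ×ˢ c₂).sup' (h1.product h2) (fun p => α p.1 p.2) :=
    Finset.le_sup' (fun p : Fin m × Fin m => α p.1 p.2) (Finset.mk_mem_product hi hj)
  have hci := hcrit i
  have hcj := hcrit j
  generalize (c₁ ×ˢ c₂).sup' (h1.product h2) (fun p => α p.1 p.2) = S at *
  have hcos : α i j = Real.cos (InnerProductGeometry.angle (g i) (g j)) := by
    rw [hα, InnerProductGeometry.cos_angle]
  have hm1 := Real.neg_one_le_cos (InnerProductGeometry.angle (g i) (g j))
  rw [hγ] at hci hcj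
  have hpos : 0 < Real.sqrt ((1 - S) / 2) := lt_of_le_of_lt (by positivity) hci
  have hsq : Real.sqrt ((1 - S) / 2) ^ 2 = (1 - S) / 2 :=
    Real.sq_sqrt (Real.sqrt_pos.1 hpos).le
  have hs1 : Real.sqrt ((1 - S) / 2) ≤ 1 := by
    rw [Real.sqrt_le_one]; linarith
  have hni := hnoise i
  have hnj := hnoise j
  rw [← hij] at hnj hcj
  have A := aux_angle_s10 _ _ hni _ hs1 hci
  have B := aux_angle_s10 _ _ hnj _ hs1 hcj
  have T := InnerProductGeometry.angle_le_angle_add_angle (g i) (G (I i)) (g j)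
  rw [InnerProductGeometry.angle_comm (g i) (G (I i))] at T
  have hlt := Real.cos_lt_cos_of_nonneg_of_le_pi
    (InnerProductGeometry.angle_nonneg (g i) (g j))
    (y := 2 * Real.arcsin (Real.sqrt ((1 - S) / 2)))
    (by linarith [Real.arcsin_le_pi_div_two (Real.sqrt ((1 - S) / 2))]) (by linarith)
  rw [Real.cos_two_mul, Real.cos_sq', Real.sin_arcsin (by linarith) hs1, hsq] at hlt
  linarith
end
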